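/- arXiv:0905.2063 — 2 statements merged into one kernel-verified Lean document; each statement's English description precedes it below -/
import Mathlib

section
/- Let A be a noetherian commutative ring, let I ⊆ A be an ideal with generators f₁,…,fᵣ, and let K = K(f₁,…,fᵣ) be the Koszul complex on these generators. Then K is a compact object of D_I(A), and K generates D_I(A): for every object M of D_I(A), if Hom_{D(A)}(K[i], M) = 0 for all i ∈ ℤ, then M ≅ 0. (This is the affine case of the main theorem: via the standard equivalence D_qct(Spf A) ≃ D_I(A), the derived category of sheaves with quasi-coherent torsion homology on the affine formal scheme Spf(A) is generated by a single perfect complex.) -/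
/-!
STATEMENT 3: Let `A` be a noetherian commutative ring, `I = (f₁, …, fᵣ)` an ideal and
`K = K(f₁, …, fᵣ)` the Koszul complex on the generators. Then `K` is a compact object of
`D_I(A)`, and `K` generates `D_I(A)`: for every `M` in `D_I(A)`, if
`Hom_{D(A)}(K[i], M) = 0` for all `i ∈ ℤ`, then `M ≅ 0`.
-/

universe w u

open CategoryTheory Limits

/-- The Koszul complex on a list of elements of `A`, built as an iterated mapping cone:
`K(∅) = A` (in degree `0`), and `K(f :: l) = Cone(f • id : K(l) ⟶ K(l))`, which agrees with
the usual tensor product of the two-term complexes `A ⟶[fⱼ] A`. -/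
noncomputable def koszulList {A : Type u} [CommRing A] :
    List A → CochainComplex (ModuleCat.{u} A) ℤ
  | [] => (HomologicalComplex.single (ModuleCat.{u} A) (ComplexShape.up ℤ) 0).obj
      (ModuleCat.of A A)
  | f :: l => CochainComplex.mappingCone (f • 𝟙 (koszulList l))

/-- An `A`-module `M` is `I`-torsion if every element of `M` is annihilated by some power
of `I`. -/
def IsTorsionWrt {A : Type u} [CommRing A] (I : Ideal A) (M : Type*) [AddCommGroup M]
    [Module A M] : Prop :=
  ∀ m : M, ∃ k : ℕ, ∀ a ∈ I ^ k, a • m = 0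

/-- `D_I(A)`: the class of objects of the unbounded derived category `D(A)` all of whose
homology modules are `I`-torsion. -/
def DTor {A : Type u} [CommRing A] [HasDerivedCategory.{w} (ModuleCat.{u} A)] (I : Ideal A) :
    Set (DerivedCategory (ModuleCat.{u} A)) :=
  {M | ∀ n : ℤ, IsTorsionWrt I ((DerivedCategory.homologyFunctor (ModuleCat.{u} A) n).obj M)}

/-- The canonical comparison map `⨁ⱼ Hom(E, Y j) →+ Hom(E, ∐ Y)`. -/
noncomputable def coproductComparison {T : Type u} [Category.{w} T] [Preadditive T]
    (E : T) {J : Type u} [DecidableEq J] (Y : J → T) [HasCoproduct Y] :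
    DirectSum J (fun j => E ⟶ Y j) →+ (E ⟶ ∐ Y) :=
  DirectSum.toAddMonoid (fun j => AddMonoidHom.mk' (fun f => f ≫ Sigma.ι Y j)
    (fun f g => by simp [Preadditive.add_comp]))

/-- An object `E` of a full subcategory `S` (whose Hom's and coproducts are computed in the
ambient category `T`) is a compact object of `S` if `Hom(E, −)` commutes with arbitrary
coproducts of families of objects of `S`. -/
def IsCompactObjIn {T : Type u} [Category.{w} T] [Preadditive T] (S : Set T) (E : T) : Prop :=
  ∀ (J : Type u) [DecidableEq J] (Y : J → T) [HasCoproduct Y],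
    (∀ j : J, Y j ∈ S) → Function.Bijective (coproductComparison E Y)

/-- The elements which are finite sums of their images under a family of endomorphisms. -/
def finiteSums {R M κ : Type*} [Ring R] [AddCommGroup M] [Module R M] (e : κ → M →ₗ[R] M) :
    Submodule R M where
  carrier := {x | ∃ s : Finset κ, ∀ t, s ⊆ t → ∑ j ∈ t, e j x = x}
  zero_mem' := ⟨∅, fun t _ => by simp⟩
  add_mem' := by
    classical
    rintro x y ⟨s, hs⟩ ⟨s', hs'⟩
    refine ⟨s ∪ s', fun t ht => ?_⟩
    simp only [map_add, Finset.sum_add_distrib]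
    rw [hs t (Finset.union_subset_left ht), hs' t (Finset.union_subset_right ht)]
  smul_mem' := by
    rintro a x ⟨s, hs⟩
    exact ⟨s, fun t ht => by simp only [map_smul, ← Finset.smul_sum, hs t ht]⟩

lemma finiteSums.exists_sum_eq {R M κ : Type*} [Ring R] [AddCommGroup M] [Module R M]
    {e : κ → M →ₗ[R] M} {x : M} (hx : x ∈ finiteSums e) :
    ∃ s : Finset κ, ∑ j ∈ s, e j x = x :=
  hx.imp fun _ hs => hs _ subset_rfl

lemma finiteSums.mem_of_apply {R M κ : Type*} [Ring R] [AddCommGroup M] [Module R M]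
    {e : κ → M →ₗ[R] M} {x : M} (j : κ) (hj : e j x = x) (h : ∀ k, j ≠ k → e k x = 0) :
    x ∈ finiteSums e :=
  ⟨{j}, fun t ht => by
    rw [Finset.sum_eq_single j (fun k _ hk => h k hk.symm)
      (fun hj => absurd (ht (Finset.mem_singleton_self j)) hj), hj]⟩

section FiniteSums

variable (R : Type*) [CommRing R] {C : Type*} [Category* C] [Preadditive C] [Linear R C]
  {κ : Type*} [DecidableEq κ] (Y : κ → C) [HasCoproduct Y]

/-- The morphisms to a coproduct which are finite sums of their components. -/
noncomputable def finiteSumHoms (X : C) : Submodule R (X ⟶ ∐ Y) :=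
  finiteSums fun j => Linear.rightComp R X (Sigma.π Y j ≫ Sigma.ι Y j)

variable {Y}

lemma comp_ι_mem_finiteSumHoms {X : C} {j : κ} (φ : X ⟶ Y j) :
    φ ≫ Sigma.ι Y j ∈ finiteSumHoms R Y X :=
  finiteSums.mem_of_apply j (by simp) fun k hk => by
    simp [Sigma.ι_π_of_ne_assoc _ hk]

variable {R}

lemma exists_sum_eq_of_mem_finiteSumHoms {X : C} {φ : X ⟶ ∐ Y} (hφ : φ ∈ finiteSumHoms R Y X) :
    ∃ s : Finset κ, ∑ j ∈ s, φ ≫ Sigma.π Y j ≫ Sigma.ι Y j = φ :=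
  finiteSums.exists_sum_eq hφ

lemma comp_mem_finiteSumHoms {X X' : C} (f : X' ⟶ X) {φ : X ⟶ ∐ Y}
    (hφ : φ ∈ finiteSumHoms R Y X) : f ≫ φ ∈ finiteSumHoms R Y X' := by
  obtain ⟨s, hs⟩ := exists_sum_eq_of_mem_finiteSumHoms hφ
  rw [← hs, Preadditive.comp_sum]
  refine Submodule.sum_mem _ fun j _ => ?_
  rw [← Category.assoc, ← Category.assoc]
  exact comp_ι_mem_finiteSumHoms R _

end FiniteSums

section SingleComplex

variable {C : Type*} [Category* C] [Abelian C]

/-- The cochain complex with `P` in degree `n`. -/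
noncomputable def singleComplex (P : C) (n : ℤ) : CochainComplex C ℤ :=
  (HomologicalComplex.single C (ComplexShape.up ℤ) n).obj P

namespace singleComplex

/-- The identification of `P` with the degree `n` term of `singleComplex P n`. -/
noncomputable def incl (P : C) (n : ℤ) : P ⟶ (singleComplex P n).X n :=
  (HomologicalComplex.singleObjXSelf (ComplexShape.up ℤ) n P).inv

instance (P : C) (n : ℤ) : IsIso (incl P n) := by
  unfold incl singleComplex
  infer_instance

lemma isZero_X (P : C) (n i : ℤ) (h : i ≠ n) : IsZero ((singleComplex P n).X i) :=
  HomologicalComplex.isZero_single_obj_X _ _ _ _ h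

@[simp]
lemma d_eq_zero (P : C) (n i j : ℤ) : (singleComplex P n).d i j = 0 := rfl

lemma hom_ext {P : C} {n : ℤ} {X : CochainComplex C ℤ} {g h : singleComplex P n ⟶ X}
    (H : incl P n ≫ g.f n = incl P n ≫ h.f n) : g = h := by
  ext i
  by_cases hi : i = n
  · subst hi
    exact (cancel_epi (incl P i)).1 H
  · exact (isZero_X P n i hi).eq_of_src _ _

lemma exists_hom {P : C} {n : ℤ} {X : CochainComplex C ℤ} (φ : P ⟶ X.X n)
    (hφ : φ ≫ X.d n (n + 1) = 0) :
    ∃ g : singleComplex P n ⟶ X, incl P n ≫ g.f n = φ := by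
  refine ⟨HomologicalComplex.mkHomFromSingle φ (fun k hk => ?_), ?_⟩
  · obtain rfl : n + 1 = k := hk
    exact hφ
  · exact (congrArg (_ ≫ ·) (HomologicalComplex.mkHomFromSingle_f φ _)).trans
      (Iso.inv_hom_id_assoc _ _)

lemma nonempty_homotopy_zero {P : C} {n : ℤ} {X : CochainComplex C ℤ}
    (g : singleComplex P n ⟶ X) (h : P ⟶ X.X (n - 1))
    (hg : h ≫ X.d (n - 1) n = incl P n ≫ g.f n) : Nonempty (Homotopy g 0) := by
  let z : CochainComplex.HomComplex.Cochain ((CochainComplex.singleFunctor C n).obj P) X (-1) :=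
    CochainComplex.HomComplex.Cochain.fromSingleMk h (by lia)
  have hz := CochainComplex.HomComplex.Cochain.δ_fromSingleMk h
    (show n + (-1) = n - 1 by lia) 0 n (by lia)
  let g' : (CochainComplex.singleFunctor C n).obj P ⟶ X := g
  have hg' : CochainComplex.HomComplex.Cochain.ofHom g' =
      CochainComplex.HomComplex.δ (-1) 0 z + CochainComplex.HomComplex.Cochain.ofHom 0 := by
    rw [hz, CochainComplex.HomComplex.Cochain.ofHom_zero, add_zero, hg]
    apply (CochainComplex.HomComplex.Cochain.fromSingleEquiv (add_zero n)).injective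
    rw [CochainComplex.HomComplex.Cochain.fromSingleEquiv_fromSingleMk]
    exact congrArg (_ ≫ ·) (CochainComplex.HomComplex.Cochain.ofHom_v g' n)
  exact ⟨(CochainComplex.HomComplex.Cochain.equivHomotopy g' 0).symm ⟨z, hg'⟩⟩

instance isKProjective (P : C) [Projective P] (n : ℤ) :
    (singleComplex P n).IsKProjective := by
  have : ∀ i, Projective ((singleComplex P n).X i) := by
    intro i
    by_cases h : i = n
    · subst h
      exact Projective.of_iso (asIso (incl P i)) inferInstance
    · exact Projective.of_iso (isZero_X P n i h).isoZero.symm inferInstance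
  have : (singleComplex P n).IsStrictlyLE n := by
    rw [CochainComplex.isStrictlyLE_iff]
    intro i hi
    exact isZero_X P n i hi.ne'
  exact CochainComplex.isKProjective_of_projective _ n

/-- The class of the identity of `P` in the homology of `singleComplex P n`. -/
noncomputable def toHomology (P : C) (n : ℤ) : P ⟶ (singleComplex P n).homology n :=
  (singleComplex P n).liftCycles (incl P n) (n + 1) (by simp) (by simp) ≫
    (singleComplex P n).homologyπ n

lemma toHomology_homologyMap {P : C} {n : ℤ} {X : CochainComplex C ℤ}
    (g : singleComplex P n ⟶ X) :
    toHomology P n ≫ HomologicalComplex.homologyMap g n =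
      X.liftCycles (incl P n ≫ g.f n) (n + 1) (by simp) (by simp) ≫ X.homologyπ n := by
  simp [toHomology]

lemma exists_toHomology_homologyMap_eq {P : C} [Projective P] {n : ℤ} {X : CochainComplex C ℤ}
    (v : P ⟶ X.homology n) :
    ∃ g : singleComplex P n ⟶ X, toHomology P n ≫ HomologicalComplex.homologyMap g n = v := by
  let w := Projective.factorThru v (X.homologyπ n)
  obtain ⟨g, hg⟩ := exists_hom (X := X) (w ≫ X.iCycles n) (by simp)
  refine ⟨g, ?_⟩
  have : X.liftCycles (incl P n ≫ g.f n) (n + 1) (by simp) (by simp) = w := by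
    rw [← cancel_mono (X.iCycles n)]
    simp [hg]
  rw [toHomology_homologyMap, this]
  simp [w]

lemma nonempty_homotopy_zero_of_homologyMap {P : C} [Projective P] {n : ℤ}
    {X : CochainComplex C ℤ} (g : singleComplex P n ⟶ X)
    (hg : toHomology P n ≫ HomologicalComplex.homologyMap g n = 0) :
    Nonempty (Homotopy g 0) := by
  rw [toHomology_homologyMap] at hg
  have hex : (ShortComplex.mk _ _ (X.toCycles_comp_homologyπ (n - 1) n)).Exact :=
    ShortComplex.exact_of_g_is_cokernel _ (X.homologyIsCokernel (n - 1) n (by simp))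
  obtain ⟨h, hh⟩ : ∃ h, h ≫ X.toCycles (n - 1) n = X.liftCycles (incl P n ≫ g.f n) (n + 1)
      (by simp) (by simp) := ⟨hex.liftFromProjective _ hg, hex.liftFromProjective_comp _ hg⟩
  refine nonempty_homotopy_zero g h ?_
  simpa using congrArg (· ≫ X.iCycles n) hh

end singleComplex

end SingleComplex

lemma mem_finiteSumHoms_of_singleComplex {A : Type u} [CommRing A] {κ : Type u} [DecidableEq κ]
    (X : κ → CochainComplex (ModuleCat.{u} A) ℤ) {n : ℤ}
    (g : singleComplex (ModuleCat.of A A) n ⟶ ∐ X) : g ∈ finiteSumHoms A X _ := by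
  let e (j : κ) : (∐ X).X n →ₗ[A] (∐ X).X n := ((Sigma.π X j ≫ Sigma.ι X j).f n).hom
  have hX {Q : ModuleCat.{u} A} (f : (∐ X).X n ⟶ Q) (hf : ∀ j, (Sigma.ι X j).f n ≫ f = 0) :
      f = 0 :=
    (isColimitOfPreserves (HomologicalComplex.eval _ _ n) (coproductIsCoproduct X)).hom_ext
      fun ⟨j⟩ => (hf j).trans comp_zero.symm
  have he : finiteSums e = ⊤ := by
    have h : ModuleCat.ofHom (finiteSums e).mkQ = 0 := by
      refine hX _ fun j => ?_
      ext x
      refine (Submodule.Quotient.mk_eq_zero _).2 (finiteSums.mem_of_apply j ?_ fun k hk => ?_)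
      · have : Sigma.ι X j ≫ Sigma.π X j ≫ Sigma.ι X j = Sigma.ι X j := by simp
        exact congrArg (fun f => (f.f n).hom x) this
      · have : Sigma.ι X j ≫ Sigma.π X k ≫ Sigma.ι X k = 0 := by
          simp [Sigma.ι_π_of_ne_assoc _ hk]
        exact congrArg (fun f => (f.f n).hom x) this
    rw [← (finiteSums e).ker_mkQ, ← ModuleCat.hom_ofHom (finiteSums e).mkQ, h]
    exact LinearMap.ker_zero
  let x : (∐ X).X n := (singleComplex.incl (ModuleCat.of A A) n ≫ g.f n).hom (1 : A)
  obtain ⟨s, hs⟩ : x ∈ finiteSums e := by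
    rw [he]
    trivial
  let ev : (singleComplex (ModuleCat.of A A) n ⟶ ∐ X) →+ (∐ X).X n :=
    AddMonoidHom.mk' (fun f => (singleComplex.incl (ModuleCat.of A A) n ≫ f.f n).hom (1 : A))
      fun f f' => by simp
  refine ⟨s, fun t ht => singleComplex.hom_ext (ModuleCat.hom_ext (LinearMap.ext_ring ?_))⟩
  exact (map_sum ev _ t).trans (hs t ht)

namespace DerivedCategory

section

variable {C : Type*} [Category* C] [Abelian C] [HasDerivedCategory C]

lemma exists_Q_map_eq_of_isKProjective {K L : CochainComplex C ℤ} [K.IsKProjective]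
    (φ : Q.obj K ⟶ Q.obj L) : ∃ g : K ⟶ L, Q.map g = φ := by
  obtain ⟨g, hg⟩ := (CochainComplex.IsKProjective.Qh_map_bijective K
    ((HomotopyCategory.quotient _ _).obj L)).surjective
    ((quotientCompQhIso C).hom.app K ≫ φ ≫ (quotientCompQhIso C).inv.app L)
  obtain ⟨g, rfl⟩ := (HomotopyCategory.quotient _ _).map_surjective g
  refine ⟨g, ?_⟩
  rw [← cancel_epi ((quotientCompQhIso C).hom.app K), ← quotientCompQhIso_hom_naturality, hg]
  simp

/-- The homology of `Q.obj X` is the homology of `X`. -/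
noncomputable def homologyQIso (X : CochainComplex C ℤ) (n : ℤ) :
    (homologyFunctor C n).obj (Q.obj X) ≅ X.homology n :=
  (homologyFunctorFactors C n).app X

lemma homologyQIso_inv_naturality {X Y : CochainComplex C ℤ} (g : X ⟶ Y) (n : ℤ) :
    (homologyQIso X n).inv ≫ (homologyFunctor C n).map (Q.map g) =
      HomologicalComplex.homologyMap g n ≫ (homologyQIso Y n).inv :=
  ((homologyFunctorFactors C n).inv.naturality g).symm

/-- The tautological map from `P` to the homology of `P` placed in degree `n`. -/
noncomputable def toHomologySingle (P : C) (n : ℤ) :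
    P ⟶ (homologyFunctor C n).obj (Q.obj (singleComplex P n)) :=
  singleComplex.toHomology P n ≫ (homologyQIso _ n).inv

lemma toHomologySingle_map_Q {P : C} {n : ℤ} {X : CochainComplex C ℤ}
    (g : singleComplex P n ⟶ X) :
    toHomologySingle P n ≫ (homologyFunctor C n).map (Q.map g) =
      (singleComplex.toHomology P n ≫ HomologicalComplex.homologyMap g n) ≫
        (homologyQIso X n).inv := by
  simp [toHomologySingle, homologyQIso_inv_naturality]

variable {P : C} [Projective P] {n : ℤ} {M : DerivedCategory C}

lemma exists_toHomologySingle_map_eq (v : P ⟶ (homologyFunctor C n).obj M) :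
    ∃ φ : Q.obj (singleComplex P n) ⟶ M,
      toHomologySingle P n ≫ (homologyFunctor C n).map φ = v := by
  let e := Q.objObjPreimageIso M
  obtain ⟨g, hg⟩ := singleComplex.exists_toHomology_homologyMap_eq
    (v ≫ (homologyFunctor C n).map e.inv ≫ (homologyQIso _ n).hom)
  refine ⟨Q.map g ≫ e.hom, ?_⟩
  rw [Functor.map_comp, ← Category.assoc, toHomologySingle_map_Q, hg]
  simp only [Category.assoc, Iso.hom_inv_id_assoc, Iso.map_inv_hom_id, Category.comp_id]

lemma eq_zero_of_toHomologySingle_map {φ : Q.obj (singleComplex P n) ⟶ M}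
    (hφ : toHomologySingle P n ≫ (homologyFunctor C n).map φ = 0) : φ = 0 := by
  let e := Q.objObjPreimageIso M
  obtain ⟨g, hg⟩ := exists_Q_map_eq_of_isKProjective (φ ≫ e.inv)
  have h : toHomologySingle P n ≫ (homologyFunctor C n).map (Q.map g) = 0 := by
    rw [hg, Functor.map_comp, reassoc_of% hφ, zero_comp]
  rw [toHomologySingle_map_Q, Preadditive.IsIso.comp_right_eq_zero] at h
  obtain ⟨H⟩ := singleComplex.nonempty_homotopy_zero_of_homologyMap g h
  rw [← cancel_mono e.inv, ← hg, Q_map_eq_of_homotopy (C := C) H, Functor.map_zero, zero_comp]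

lemma isZero_of_isZero_homology (h : ∀ n, IsZero ((homologyFunctor C n).obj M)) : IsZero M := by
  have : IsIso (0 : M ⟶ M) := by
    rw [isIso_iff]
    exact fun n => (h n).isIso (h n) _
  rw [IsZero.iff_id_eq_zero, ← IsIso.hom_inv_id (0 : M ⟶ M), zero_comp]

instance (R : Type*) [Ring R] [Linear R C] (n : ℤ) : (homologyFunctor C n).Linear R := by
  have : (HomologicalComplex.homologyFunctor C (ComplexShape.up ℤ) n).Linear R :=
    { map_smul := fun {X Y} f r =>
        ShortComplex.homologyMap_smul ((HomologicalComplex.shortComplexFunctor C _ n).map f) r }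
  have : Localization.Lifting Q (HomologicalComplex.quasiIso C (ComplexShape.up ℤ))
      (HomologicalComplex.homologyFunctor C (ComplexShape.up ℤ) n) (homologyFunctor C n) :=
    ⟨homologyFunctorFactors C n⟩
  exact (Localization.functor_linear_iff Q (HomologicalComplex.quasiIso C (ComplexShape.up ℤ)) R
    (HomologicalComplex.homologyFunctor C (ComplexShape.up ℤ) n) _).1 inferInstance

end

section Koszul

open Pretriangulated

variable {A : Type u} [CommRing A] [HasDerivedCategory.{w} (ModuleCat.{u} A)]

/-- The ring `A`, placed in degree `n`, as an object of the derived category. -/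
noncomputable abbrev unitSingle (A : Type u) [CommRing A]
    [HasDerivedCategory.{w} (ModuleCat.{u} A)] (n : ℤ) : DerivedCategory (ModuleCat.{u} A) :=
  Q.obj (singleComplex (ModuleCat.of A A) n)

/-- Shifts of `A` are concentrated in a single degree. -/
noncomputable def koszulNilShiftIso (i n : ℤ) (h : i + n = 0) :
    (Q.obj (koszulList ([] : List A)))⟦i⟧ ≅ unitSingle A n :=
  ((singleFunctors (ModuleCat.{u} A)).shiftIso i n 0 h).app (ModuleCat.of A A)

/-- The triangle exhibiting `K(a :: l)` as the cone of the multiplication by `a` on `K(l)`. -/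
lemma koszul_triangle (a : A) (l : List A) :
    ∃ (g : Q.obj (koszulList l) ⟶ Q.obj (koszulList (a :: l)))
      (h : Q.obj (koszulList (a :: l)) ⟶ (Q.obj (koszulList l))⟦(1 : ℤ)⟧),
      Triangle.mk (a • 𝟙 (Q.obj (koszulList l))) g h ∈ distTriang _ := by
  have e : Q.map (a • 𝟙 (koszulList l)) = a • 𝟙 _ := by
    rw [Functor.map_smul, CategoryTheory.Functor.map_id]
  rw [← e]
  exact ⟨_, _, mappingCone_triangle_distinguished (a • 𝟙 (koszulList l))⟩

lemma koszul_shift_triangle (a : A) (l : List A) (i : ℤ) :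
    ∃ (ε : ℤˣ) (g : (Q.obj (koszulList l))⟦i⟧ ⟶ (Q.obj (koszulList (a :: l)))⟦i⟧)
      (h : (Q.obj (koszulList (a :: l)))⟦i⟧ ⟶ ((Q.obj (koszulList l))⟦i⟧)⟦(1 : ℤ)⟧),
      Triangle.mk (ε • (a • 𝟙 ((Q.obj (koszulList l))⟦i⟧))) g h ∈ distTriang _ := by
  obtain ⟨g, h, H⟩ := koszul_triangle a l
  have e : (a • 𝟙 (Q.obj (koszulList l)))⟦i⟧' = a • 𝟙 _ := by
    rw [Functor.map_smul, CategoryTheory.Functor.map_id]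
  rw [← e]
  exact ⟨i.negOnePow, _, _, Triangle.shift_distinguished _ H i⟩

/-- Induction principle for properties of objects which are stable under cones. -/
lemma koszul_shift_induction (G : ObjectProperty (DerivedCategory (ModuleCat.{u} A)))
    [G.IsClosedUnderIsomorphisms]
    (hG : ∀ T ∈ distTriang (DerivedCategory (ModuleCat.{u} A)),
      G T.obj₂ → G (T.obj₁⟦(1 : ℤ)⟧) → G T.obj₃)
    (h₀ : ∀ n, G (unitSingle A n)) (l : List A) (i : ℤ) : G ((Q.obj (koszulList l))⟦i⟧) := by
  induction l generalizing i with
  | nil => exact G.prop_of_iso (koszulNilShiftIso i (-i) (by lia)).symm (h₀ _)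
  | cons a l ih =>
    obtain ⟨_, g, h, H⟩ := koszul_shift_triangle a l i
    exact hG _ H (ih i) (G.prop_of_iso ((shiftFunctorAdd _ i 1).app _) (ih (i + 1)))

lemma eq_zero_of_apply_one {n : ℤ} {M : DerivedCategory (ModuleCat.{u} A)}
    (φ : unitSingle A n ⟶ M)
    (hφ : ((homologyFunctor _ n).map φ).hom (toHomologySingle (ModuleCat.of A A) n (1 : A)) = 0) :
    φ = 0 := by
  refine eq_zero_of_toHomologySingle_map (ModuleCat.hom_ext (LinearMap.ext_ring ?_))
  exact hφ

/-- If `a ∈ I`, all morphisms from a shift of a Koszul complex to an object of `D_I(A)` are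
`a`-power torsion. -/
lemma exists_pow_smul_eq_zero {I : Ideal A} {M : DerivedCategory (ModuleCat.{u} A)}
    (hM : M ∈ DTor I) {a : A} (ha : a ∈ I) (l : List A) (i : ℤ)
    (φ : (Q.obj (koszulList l))⟦i⟧ ⟶ M) : ∃ k : ℕ, a ^ k • φ = 0 := by
  let G : ObjectProperty (DerivedCategory (ModuleCat.{u} A)) :=
    fun X => ∀ φ : X ⟶ M, ∃ k : ℕ, a ^ k • φ = 0
  have : G.IsClosedUnderIsomorphisms := ⟨fun e h φ => by
    obtain ⟨k, hk⟩ := h (e.hom ≫ φ)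
    exact ⟨k, by rwa [← Linear.comp_smul, Preadditive.IsIso.comp_left_eq_zero] at hk⟩⟩
  refine koszul_shift_induction G (fun T hT h₂ h₁ φ => ?_) (fun n φ => ?_) l i φ
  · obtain ⟨k, hk⟩ := h₂ (T.mor₂ ≫ φ)
    obtain ⟨ψ, hψ⟩ := Triangle.yoneda_exact₃ T hT (a ^ k • φ) (by rw [Linear.comp_smul, hk])
    obtain ⟨m, hm⟩ := h₁ ψ
    exact ⟨m + k, by rw [pow_add, mul_smul, hψ, ← Linear.comp_smul, hm, comp_zero]⟩
  · obtain ⟨k, hk⟩ := hM n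
      (((homologyFunctor _ n).map φ).hom (toHomologySingle (ModuleCat.of A A) n (1 : A)))
    refine ⟨k, eq_zero_of_apply_one _ ?_⟩
    rw [Functor.map_smul]
    exact hk _ (Ideal.pow_mem_pow ha k)

/-- The Koszul complex on elements of `I` generates `D_I(A)`. -/
lemma isZero_of_koszul_hom_eq_zero {I : Ideal A} {M : DerivedCategory (ModuleCat.{u} A)}
    (hM : M ∈ DTor I) (l : List A) (hl : ∀ a ∈ l, a ∈ I)
    (h : ∀ (i : ℤ) (φ : (Q.obj (koszulList l))⟦i⟧ ⟶ M), φ = 0) : IsZero M := by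
  induction l with
  | nil =>
    refine isZero_of_isZero_homology fun n => ?_
    rw [ModuleCat.isZero_iff_subsingleton]
    refine subsingleton_of_forall_eq 0 fun x => ?_
    obtain ⟨φ, hφ⟩ := exists_toHomologySingle_map_eq (M := M) (n := n)
      (ModuleCat.ofHom (LinearMap.toSpanSingleton A _ x))
    have h₀ : φ = 0 :=
      (Preadditive.IsIso.comp_left_eq_zero (koszulNilShiftIso (-n) n (by lia)).hom φ).1 (h _ _)
    have : (ModuleCat.ofHom (LinearMap.toSpanSingleton A _ x)).hom (1 : A) = 0 := by
      rw [← hφ, h₀, Functor.map_zero, comp_zero]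
      rfl
    simpa using this
  | cons a l ih =>
    refine ih (fun b hb => hl b (List.mem_cons_of_mem a hb)) fun i φ => ?_
    obtain ⟨ε, g, h', H⟩ := koszul_shift_triangle a l i
    have key (φ : (Q.obj (koszulList l))⟦i⟧ ⟶ M) (hφ : a • φ = 0) : φ = 0 := by
      have hφ' : (ε • (a • 𝟙 ((Q.obj (koszulList l))⟦i⟧))) ≫ φ = 0 := by
        rw [Linear.units_smul_comp, Linear.smul_comp, Category.id_comp, hφ, smul_zero]
      obtain ⟨ψ, hψ⟩ := Triangle.yoneda_exact₂ _ H φ hφ'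
      exact hψ.trans ((congrArg (_ ≫ ·) (h i ψ)).trans comp_zero)
    obtain ⟨k, hk⟩ := exists_pow_smul_eq_zero hM (hl a List.mem_cons_self) l i φ
    induction k with
    | zero => simpa using hk
    | succ k ihk => exact ihk (key _ (by rwa [smul_smul, ← pow_succ']))

lemma mul_self_smul_id_eq_zero {X Y : DerivedCategory (ModuleCat.{u} A)} {u : X ⟶ X} {v : X ⟶ Y}
    {w : Y ⟶ X⟦(1 : ℤ)⟧} (H : Triangle.mk u v w ∈ distTriang _) {b : A} (hv : b • v = 0)
    (hw : b • w = 0) : (b * b) • 𝟙 Y = 0 := by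
  have hb : v ≫ (b • 𝟙 Y) = 0 := by rw [Linear.comp_smul, Category.comp_id, hv]
  obtain ⟨ψ, hψ⟩ : ∃ ψ : X⟦(1 : ℤ)⟧ ⟶ Y, b • 𝟙 Y = w ≫ ψ :=
    Triangle.yoneda_exact₃ _ H (b • 𝟙 Y) hb
  rw [mul_smul, hψ, ← Linear.smul_comp, hw, zero_comp]

lemma smul_id_koszul_cons_eq_zero (a : A) {b : A} {l : List A}
    (hb : b • 𝟙 (Q.obj (koszulList l)) = 0) :
    (b * b) • 𝟙 (Q.obj (koszulList (a :: l))) = 0 := by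
  obtain ⟨g, h, H⟩ := koszul_triangle a l
  refine mul_self_smul_id_eq_zero H ?_ ?_
  · rw [← Category.id_comp g, ← Linear.smul_comp, hb, zero_comp]
  · rw [← Category.comp_id h, ← CategoryTheory.Functor.map_id, ← Linear.comp_smul,
      ← Functor.map_smul, hb, Functor.map_zero, comp_zero]

lemma mul_self_smul_id_koszul_cons (a : A) (l : List A) :
    (a * a) • 𝟙 (Q.obj (koszulList (a :: l))) = 0 := by
  obtain ⟨g, h, H⟩ := koszul_triangle a l
  refine mul_self_smul_id_eq_zero H ?_ ?_
  · rw [← Category.id_comp g, ← Linear.smul_comp]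
    exact comp_distTriang_mor_zero₁₂ _ H
  · rw [← Category.comp_id h, ← CategoryTheory.Functor.map_id, ← Linear.comp_smul,
      ← Functor.map_smul]
    exact comp_distTriang_mor_zero₃₁ _ H

lemma exists_pow_smul_id_koszul_eq_zero {a : A} {l : List A} (ha : a ∈ l) :
    ∃ k : ℕ, a ^ k • 𝟙 (Q.obj (koszulList l)) = 0 := by
  induction l with
  | nil => simp at ha
  | cons b l ih =>
    obtain rfl | h := List.mem_cons.1 ha
    · exact ⟨2, by rw [pow_two, mul_self_smul_id_koszul_cons]⟩
    · obtain ⟨k, hk⟩ := ih h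
      exact ⟨k + k, by rw [pow_add, smul_id_koszul_cons_eq_zero _ hk]⟩

/-- The homology of the Koszul complex on generators of `I` is `I`-torsion. -/
lemma koszul_mem_DTor {I : Ideal A} (l : List A) (hI : I = Ideal.span {a | a ∈ l}) :
    Q.obj (koszulList l) ∈ DTor I := by
  let N : Ideal A := (LinearMap.toSpanSingleton A _ (𝟙 (Q.obj (koszulList l)))).ker
  have hN (a : A) : a ∈ N ↔ a • 𝟙 (Q.obj (koszulList l)) = 0 := Iff.rfl
  obtain ⟨k, hk⟩ : ∃ k : ℕ, I ^ k ≤ N := by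
    refine Ideal.exists_pow_le_of_le_radical_of_fg ?_ ?_
    · rw [hI, Ideal.span_le]
      intro a ha
      obtain ⟨k, hk⟩ := exists_pow_smul_id_koszul_eq_zero ha
      exact ⟨k, hk⟩
    · rw [hI]
      exact Submodule.fg_span (List.finite_toSet l)
  refine fun n x => ⟨k, fun a ha => ?_⟩
  have h : a • 𝟙 ((homologyFunctor _ n).obj (Q.obj (koszulList l))) = 0 := by
    rw [← CategoryTheory.Functor.map_id, ← Functor.map_smul, (hN a).1 (hk ha), Functor.map_zero]
  exact congrArg (fun f => f.hom x) h

/-- Every morphism to `Q.obj Z` is, up to an isomorphism of its source, the image of a morphism of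
complexes. -/
lemma exists_iso_Q_map_eq {Y : DerivedCategory (ModuleCat.{u} A)}
    {Z : CochainComplex (ModuleCat.{u} A) ℤ} (m : Y ⟶ Q.obj Z) :
    ∃ (X : CochainComplex (ModuleCat.{u} A) ℤ) (h : X ⟶ Z) (i : Y ≅ Q.obj X),
      i.hom ≫ Q.map h = m := by
  obtain ⟨X, s, _, h, hf⟩ := right_fac ((Q.objObjPreimageIso Y).hom ≫ m)
  refine ⟨X, h, (Q.objObjPreimageIso Y).symm ≪≫ (asIso (Q.map s)).symm, ?_⟩
  simp [← hf]

/-- A family of objects of the derived category which has a coproduct has only a small set of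
nonzero members. -/
lemma small_not_isZero {J : Type*} [DecidableEq J]
    (Y : J → DerivedCategory (ModuleCat.{u} A)) [HasCoproduct Y] :
    Small.{u} {j // ¬ IsZero (Y j)} := by
  have (j : {j // ¬ IsZero (Y j)}) :
      ∃ (n : ℤ) (y : (homologyFunctor (ModuleCat.{u} A) n).obj (Y j)), y ≠ 0 := by
    by_contra! h
    refine j.2 (isZero_of_isZero_homology fun n => ?_)
    rw [ModuleCat.isZero_iff_subsingleton]
    exact subsingleton_of_forall_eq 0 (h n)
  choose n y hy using this
  let F (j : {j // ¬ IsZero (Y j)}) : Σ n : ℤ, (homologyFunctor (ModuleCat.{u} A) n).obj (∐ Y) :=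
    ⟨n j, ((homologyFunctor _ (n j)).map (Sigma.ι Y j)).hom (y j)⟩
  refine small_of_injective (f := F) fun j k hjk => ?_
  by_contra hne
  let p (z : Σ n : ℤ, (homologyFunctor (ModuleCat.{u} A) n).obj (∐ Y)) : Prop :=
    ((homologyFunctor _ z.1).map (Sigma.π Y j.1)).hom z.2 = 0
  have hj : ¬ p (F j) := by
    have h := congrArg (homologyFunctor _ (n j)).map (Sigma.ι_π_eq_id Y j.1)
    rw [Functor.map_comp, CategoryTheory.Functor.map_id] at h
    refine fun hp => hy j (Eq.trans ?_ hp)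
    exact (congrArg (fun f => f.hom (y j)) h).symm
  have hk : p (F k) := by
    have h := congrArg (homologyFunctor _ (n k)).map
      (Sigma.ι_π_of_ne Y (fun h => hne (Subtype.ext h.symm)) : Sigma.ι Y k.1 ≫ Sigma.π Y j.1 = 0)
    rw [Functor.map_comp, Functor.map_zero] at h
    exact congrArg (fun f => f.hom (y k)) h
  exact hj (hjk ▸ hk)

lemma mem_finiteSumHoms_of_unitSingle {J : Type*} [DecidableEq J]
    (Y : J → DerivedCategory (ModuleCat.{u} A)) [HasCoproduct Y] {n : ℤ}
    (φ : unitSingle A n ⟶ ∐ Y) : φ ∈ finiteSumHoms A Y _ := by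
  classical
  let e := Q.objObjPreimageIso (∐ Y)
  choose X h i hi using fun j => exists_iso_Q_map_eq (Sigma.ι Y j ≫ e.inv)
  have := small_not_isZero Y
  let σ := (equivShrink.{u} {j // ¬ IsZero (Y j)}).symm
  let s : ∐ (fun k => X (σ k)) ⟶ Q.objPreimage (∐ Y) := Sigma.desc fun k => h (σ k)
  have ht (j : J) : ∃ t : Y j ⟶ Q.obj (∐ fun k => X (σ k)), t ≫ Q.map s = Sigma.ι Y j ≫ e.inv := by
    by_cases hj : IsZero (Y j)
    · exact ⟨0, hj.eq_of_src _ _⟩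
    · obtain ⟨k, hk⟩ := σ.surjective ⟨j, hj⟩
      obtain rfl : (σ k).1 = j := by rw [hk]
      refine ⟨(i _).hom ≫ Q.map (Sigma.ι (fun k => X (σ k)) k), ?_⟩
      rw [Category.assoc, ← Functor.map_comp, Sigma.ι_desc, hi]
  choose t ht using ht
  have hts : Sigma.desc t ≫ Q.map s ≫ e.hom = 𝟙 _ := by
    refine Sigma.hom_ext _ _ fun j => ?_
    rw [Sigma.ι_desc_assoc, reassoc_of% (ht j), Iso.inv_hom_id, Category.comp_id]
  obtain ⟨g, hg⟩ := exists_Q_map_eq_of_isKProjective (φ ≫ Sigma.desc t)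
  obtain ⟨S, hS⟩ := exists_sum_eq_of_mem_finiteSumHoms (mem_finiteSumHoms_of_singleComplex _ g)
  rw [← Category.comp_id φ, ← hts, ← Category.assoc, ← hg, ← hS, Functor.map_sum,
    Preadditive.sum_comp]
  refine Submodule.sum_mem _ fun k _ => ?_
  have : Q.map (g ≫ Sigma.π (fun k => X (σ k)) k ≫ Sigma.ι (fun k => X (σ k)) k) ≫
        Q.map s ≫ e.hom =
      (Q.map (g ≫ Sigma.π (fun k => X (σ k)) k) ≫ (i (σ k)).inv) ≫ Sigma.ι Y (σ k) := by
    have hι : Sigma.ι Y (σ k) = (i (σ k)).hom ≫ Q.map (h (σ k)) ≫ e.hom := by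
      rw [reassoc_of% (hi (σ k)), Iso.inv_hom_id, Category.comp_id]
    rw [hι, Category.assoc, Iso.inv_hom_id_assoc, ← Category.assoc, ← Category.assoc,
      ← Functor.map_comp_assoc, ← Functor.map_comp]
    simp only [Category.assoc, s, Sigma.ι_desc]
  rw [this]
  exact comp_ι_mem_finiteSumHoms A _

lemma mem_finiteSumHoms_of_koszul_shift {J : Type*} [DecidableEq J]
    (Y : J → DerivedCategory (ModuleCat.{u} A)) [HasCoproduct Y] (l : List A) (i : ℤ)
    (φ : (Q.obj (koszulList l))⟦i⟧ ⟶ ∐ Y) :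
    φ ∈ finiteSumHoms A Y _ := by
  let G : ObjectProperty (DerivedCategory (ModuleCat.{u} A)) :=
    fun X => ∀ φ : X ⟶ ∐ Y, φ ∈ finiteSumHoms A Y X
  have : G.IsClosedUnderIsomorphisms := ⟨fun e h φ => by
    rw [← e.inv_hom_id_assoc φ]
    exact comp_mem_finiteSumHoms _ (h _)⟩
  refine koszul_shift_induction G (fun T hT h₂ h₁ φ => ?_)
    (fun n => mem_finiteSumHoms_of_unitSingle Y) l i φ
  obtain ⟨s, hs⟩ := exists_sum_eq_of_mem_finiteSumHoms (h₂ (T.mor₂ ≫ φ))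
  obtain ⟨ψ, hψ⟩ := Triangle.yoneda_exact₃ T hT
    (φ - ∑ j ∈ s, (φ ≫ Sigma.π Y j) ≫ Sigma.ι Y j) (by
      rw [Preadditive.comp_sub, Preadditive.comp_sum, sub_eq_zero]
      simpa using hs.symm)
  rw [eq_add_of_sub_eq hψ]
  exact add_mem (comp_mem_finiteSumHoms _ (h₁ ψ))
    (Submodule.sum_mem _ fun j _ => comp_ι_mem_finiteSumHoms A _)

/-- Koszul complexes are compact. -/
lemma isCompactObjIn_koszul (S : Set (DerivedCategory (ModuleCat.{u} A))) (l : List A) :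
    IsCompactObjIn S (Q.obj (koszulList l)) := by
  intro J _ Y _ _
  constructor
  · have key (j : J) : (Preadditive.rightComp _ (Sigma.π Y j)).comp
        (coproductComparison (Q.obj (koszulList l)) Y) = DFinsupp.evalAddMonoidHom j := by
      refine DirectSum.addHom_ext fun k f => ?_
      rw [AddMonoidHom.comp_apply, coproductComparison, DirectSum.toAddMonoid_of]
      change (f ≫ Sigma.ι Y k) ≫ Sigma.π Y j = DirectSum.of (fun j => _ ⟶ Y j) k f j
      obtain rfl | hk := eq_or_ne k j
      · simp
      · simp [Sigma.ι_π_of_ne Y hk, DirectSum.of_eq_of_ne _ _ _ hk.symm]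
    intro x y hxy
    ext j
    exact (DFunLike.congr_fun (key j) x).symm.trans
      ((congrArg (· ≫ Sigma.π Y j) hxy).trans (DFunLike.congr_fun (key j) y))
  · intro φ
    have hφ : φ ∈ finiteSumHoms A Y _ := by
      rw [← ((shiftFunctorZero _ ℤ).app (Q.obj (koszulList l))).inv_hom_id_assoc φ]
      exact comp_mem_finiteSumHoms _ (mem_finiteSumHoms_of_koszul_shift Y l 0 _)
    obtain ⟨s, hs⟩ := exists_sum_eq_of_mem_finiteSumHoms hφ
    refine ⟨∑ j ∈ s, DirectSum.of _ j (φ ≫ Sigma.π Y j), Eq.trans ?_ hs⟩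
    rw [map_sum]
    refine Finset.sum_congr rfl fun j _ => ?_
    simp [coproductComparison]

end Koszul

end DerivedCategory

theorem koszul_is_compact_generator_of_DTor
    {A : Type u} [CommRing A] [IsNoetherianRing A]
    [HasDerivedCategory.{w} (ModuleCat.{u} A)]
    (r : ℕ) (f : Fin r → A) (I : Ideal A) (hI : I = Ideal.span (Set.range f)) :
    DerivedCategory.Q.obj (koszulList (List.ofFn f)) ∈ DTor I ∧
    IsCompactObjIn (DTor I) (DerivedCategory.Q.obj (koszulList (List.ofFn f))) ∧
    (∀ M ∈ DTor I,
      (∀ (i : ℤ) (φ : (DerivedCategory.Q.obj (koszulList (List.ofFn f)))⟦i⟧ ⟶ M), φ = 0) →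
      IsZero M) := by
  have hf : {a | a ∈ List.ofFn f} = Set.range f := by
    ext a
    exact List.mem_ofFn
  refine ⟨DerivedCategory.koszul_mem_DTor _ (by rw [hI, hf]),
    DerivedCategory.isCompactObjIn_koszul _ _, fun M hM h =>
      DerivedCategory.isZero_of_koszul_hom_eq_zero hM _ (fun a ha => ?_) h⟩
  rw [hI, ← hf]
  exact Ideal.subset_span ha
end

section
/- Let A be a noetherian commutative ring and I ⊆ A an ideal. Every object M of D(A) fits into a distinguished triangle Γ → M → λ → Γ[1] in D(A) with Γ ∈ D_I(A) and λ ∈ D_I(A)^⊥ (i.e. Hom_{D(A)}(Y, λ) = 0 for every Y ∈ D_I(A)). -/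
/-!
STATEMENT 8: Let `A` be a noetherian commutative ring and `I ⊆ A` an ideal. Every object
`M` of `D(A)` fits into a distinguished triangle `Γ → M → λ → Γ[1]` with `Γ ∈ D_I(A)` and
`λ ∈ D_I(A)^⊥`.
-/

universe w u

open CategoryTheory Limits Pretriangulated

section Torsion

variable {A : Type u} [CommRing A]

/-- Over a finitely generated ideal, being `I`-torsion can be tested one element at a time. -/
lemma isTorsionWrt_iff_forall_exists_pow_smul_eq_zero {I : Ideal A} (hI : I.FG)
    {M : Type*} [AddCommGroup M] [Module A M] :
    IsTorsionWrt I M ↔ ∀ a ∈ I, ∀ m : M, ∃ k : ℕ, a ^ k • m = 0 := by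
  refine ⟨fun h a ha m ↦ ?_, fun h m ↦ ?_⟩
  · obtain ⟨k, hk⟩ := h m
    exact ⟨k, hk _ (Ideal.pow_mem_pow ha k)⟩
  · have hrad : I ≤ (Ideal.torsionOf A M m).radical := fun a ha ↦ by
      obtain ⟨k, hk⟩ := h a ha m
      exact ⟨k, (Ideal.mem_torsionOf_iff _ _).2 hk⟩
    obtain ⟨k, hk⟩ := Ideal.exists_pow_le_of_le_radical_of_fg hrad hI
    exact ⟨k, fun a ha ↦ (Ideal.mem_torsionOf_iff _ _).1 (hk ha)⟩

lemma IsTorsionWrt.mono {I J : Ideal A} (hIJ : I ≤ J) {M : Type*} [AddCommGroup M] [Module A M]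
    (h : IsTorsionWrt J M) : IsTorsionWrt I M := fun m ↦ by
  obtain ⟨k, hk⟩ := h m
  exact ⟨k, fun a ha ↦ hk a (Ideal.pow_right_mono hIJ k ha)⟩

lemma IsTorsionWrt.sup {I J : Ideal A} (hI : I.FG) (hJ : J.FG)
    {M : Type*} [AddCommGroup M] [Module A M]
    (h : IsTorsionWrt I M) (h' : IsTorsionWrt J M) : IsTorsionWrt (I ⊔ J) M := by
  intro m
  obtain ⟨k, hk⟩ := h m
  obtain ⟨l, hl⟩ := h' m
  have hrad : I ⊔ J ≤ (Ideal.torsionOf A M m).radical := sup_le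
    (fun a ha ↦ ⟨k, (Ideal.mem_torsionOf_iff _ _).2 (hk _ (Ideal.pow_mem_pow ha k))⟩)
    (fun a ha ↦ ⟨l, (Ideal.mem_torsionOf_iff _ _).2 (hl _ (Ideal.pow_mem_pow ha l))⟩)
  obtain ⟨n, hn⟩ := Ideal.exists_pow_le_of_le_radical_of_fg hrad (Submodule.FG.sup hI hJ)
  exact ⟨n, fun a ha ↦ (Ideal.mem_torsionOf_iff _ _).1 (hn ha)⟩

lemma isTorsionWrt_bot (M : Type*) [AddCommGroup M] [Module A M] :
    IsTorsionWrt (⊥ : Ideal A) M :=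
  fun m ↦ ⟨1, fun a ha ↦ by
    rw [pow_one, Ideal.mem_bot] at ha
    rw [ha, zero_smul]⟩

lemma IsTorsionWrt.of_injective {I : Ideal A} {M N : Type*} [AddCommGroup M] [Module A M]
    [AddCommGroup N] [Module A N] (f : M →ₗ[A] N) (hf : Function.Injective f)
    (h : IsTorsionWrt I N) : IsTorsionWrt I M := fun m ↦ by
  obtain ⟨k, hk⟩ := h (f m)
  exact ⟨k, fun a ha ↦ hf (by rw [map_smul, hk a ha, map_zero])⟩

lemma IsTorsionWrt.of_exact {I : Ideal A} (hI : I.FG) {M N P : Type*}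
    [AddCommGroup M] [Module A M] [AddCommGroup N] [Module A N] [AddCommGroup P] [Module A P]
    {f : M →ₗ[A] N} {g : N →ₗ[A] P} (hfg : Function.Exact f g)
    (hM : IsTorsionWrt I M) (hP : IsTorsionWrt I P) : IsTorsionWrt I N := by
  rw [isTorsionWrt_iff_forall_exists_pow_smul_eq_zero hI] at hM hP ⊢
  intro a ha n
  obtain ⟨k, hk⟩ := hP a ha (g n)
  obtain ⟨m, hm⟩ := (hfg (a ^ k • n)).1 (by rw [map_smul, hk])
  obtain ⟨l, hl⟩ := hM a ha m
  exact ⟨l + k, by rw [pow_add, mul_smul, ← hm, ← map_smul, hl, map_zero]⟩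

lemma IsTorsionWrt.localizedModule {I : Ideal A} {M : Type*} [AddCommGroup M] [Module A M]
    (h : IsTorsionWrt I M) (S : Submonoid A) : IsTorsionWrt I (LocalizedModule S M) := by
  intro m
  obtain ⟨⟨m, s⟩, rfl⟩ := IsLocalizedModule.mk'_surjective S (LocalizedModule.mkLinearMap S M) m
  obtain ⟨k, hk⟩ := h m
  refine ⟨k, fun a ha ↦ ?_⟩
  rw [Function.uncurry_apply_pair, ← IsLocalizedModule.mk'_smul, hk a ha,
    IsLocalizedModule.mk'_zero]

lemma isTorsionWrt_span_singleton_iff_subsingleton (x : A)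
    (M : Type*) [AddCommGroup M] [Module A M] :
    IsTorsionWrt (Ideal.span {x}) M ↔
      Subsingleton (LocalizedModule (Submonoid.powers x) M) := by
  rw [LocalizedModule.subsingleton_iff]
  refine forall_congr' fun m ↦ ⟨fun ⟨k, hk⟩ ↦ ⟨x ^ k, ⟨k, rfl⟩, hk _ ?_⟩, ?_⟩
  · exact Ideal.pow_mem_pow (Ideal.mem_span_singleton_self x) k
  · rintro ⟨_, ⟨k, rfl⟩, hk⟩
    refine ⟨k, fun a ha ↦ ?_⟩
    rw [Ideal.span_singleton_pow] at ha
    obtain ⟨b, rfl⟩ := Ideal.mem_span_singleton'.1 ha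
    rw [mul_smul, hk, smul_zero]

end Torsion

namespace ModuleCat

variable {A : Type u} [CommRing A] (S : Submonoid A)

/-- Localization at `S`, as an endofunctor of the category of `A`-modules. -/
noncomputable def localizationEndofunctor : ModuleCat.{u} A ⥤ ModuleCat.{u} A where
  obj M := ModuleCat.of A (LocalizedModule S M)
  map {M N} f := ModuleCat.ofHom (IsLocalizedModule.map S (LocalizedModule.mkLinearMap S M)
    (LocalizedModule.mkLinearMap S N) f.hom)
  map_id M := by
    ext1
    exact IsLocalizedModule.map_id S (LocalizedModule.mkLinearMap S M)
  map_comp {M N P} f g := by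
    ext1
    exact IsLocalizedModule.map_comp' S (LocalizedModule.mkLinearMap S M)
      (LocalizedModule.mkLinearMap S N) (LocalizedModule.mkLinearMap S P) f.hom g.hom

/-- The canonical maps from modules to their localizations at `S`. -/
noncomputable def toLocalizationEndofunctor :
    𝟭 (ModuleCat.{u} A) ⟶ localizationEndofunctor S where
  app M := ModuleCat.ofHom (LocalizedModule.mkLinearMap S M)
  naturality M N f := by
    ext m
    exact (IsLocalizedModule.map_apply S (LocalizedModule.mkLinearMap S M)
      (LocalizedModule.mkLinearMap S N) f.hom m).symm

instance : (localizationEndofunctor S).Additive where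
  map_add {M N f g} := by
    ext1
    exact map_add (IsLocalizedModule.map S (LocalizedModule.mkLinearMap S M)
      (LocalizedModule.mkLinearMap S N)) f.hom g.hom

lemma localizationEndofunctor_map_exact (T : ShortComplex (ModuleCat.{u} A)) (h : T.Exact) :
    (T.map (localizationEndofunctor S)).Exact := by
  rw [ShortComplex.ShortExact.moduleCat_exact_iff_function_exact] at h ⊢
  exact IsLocalizedModule.map_exact S (LocalizedModule.mkLinearMap S T.X₁)
    (LocalizedModule.mkLinearMap S T.X₂) (LocalizedModule.mkLinearMap S T.X₃) _ _ h

instance : PreservesFiniteLimits (localizationEndofunctor S) := by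
  have := ((Functor.exact_tfae _).out 1 3).mp (localizationEndofunctor_map_exact S)
  exact this.1

instance : PreservesFiniteColimits (localizationEndofunctor S) := by
  have := ((Functor.exact_tfae _).out 1 3).mp (localizationEndofunctor_map_exact S)
  exact this.2

instance isIso_toLocalizationEndofunctor_app_obj (M : ModuleCat.{u} A) :
    IsIso ((toLocalizationEndofunctor S).app ((localizationEndofunctor S).obj M)) := by
  rw [ConcreteCategory.isIso_iff_bijective]
  have hmul (s : S) : Function.Bijective (fun m : LocalizedModule S M ↦ s • m) :=
    (Module.End.isUnit_iff _).1
      (IsLocalizedModule.map_units (LocalizedModule.mkLinearMap S M) s)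
  change Function.Bijective (LocalizedModule.mkLinearMap S (LocalizedModule S M))
  constructor
  · rw [injective_iff_map_eq_zero]
    intro m hm
    obtain ⟨s, hs⟩ := (IsLocalizedModule.eq_zero_iff S
      (LocalizedModule.mkLinearMap S (LocalizedModule S M))).1 hm
    exact (hmul s).1 (hs.trans (smul_zero s).symm)
  · intro y
    obtain ⟨⟨m, s⟩, rfl⟩ := IsLocalizedModule.mk'_surjective S
      (LocalizedModule.mkLinearMap S (LocalizedModule S M)) y
    obtain ⟨n, rfl⟩ := (hmul s).2 m
    exact ⟨n, (IsLocalizedModule.mk'_cancel ..).symm⟩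

lemma localizationEndofunctor_map_toLocalizationEndofunctor_app (M : ModuleCat.{u} A) :
    (localizationEndofunctor S).map ((toLocalizationEndofunctor S).app M) =
      (toLocalizationEndofunctor S).app ((localizationEndofunctor S).obj M) := by
  ext1
  refine IsLocalizedModule.ext S (LocalizedModule.mkLinearMap S M)
    (IsLocalizedModule.map_units
      (LocalizedModule.mkLinearMap S (LocalizedModule S M))) ?_
  exact congrArg ModuleCat.Hom.hom
    ((toLocalizationEndofunctor S).naturality ((toLocalizationEndofunctor S).app M)).symm

instance (M : ModuleCat.{u} A) :
    IsIso ((localizationEndofunctor S).map ((toLocalizationEndofunctor S).app M)) := by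
  rw [localizationEndofunctor_map_toLocalizationEndofunctor_app]
  infer_instance

end ModuleCat

namespace DerivedCategory

section ExactEndofunctor

variable {C : Type*} [Category* C] [Abelian C]
  (F : C ⥤ C) [F.Additive]

/-- The natural transformation on cochain complexes induced by a transformation `𝟭 C ⟶ F`. -/
def toMapComplex (τ : 𝟭 C ⟶ F) :
    𝟭 (CochainComplex C ℤ) ⟶ F.mapHomologicalComplex (ComplexShape.up ℤ) :=
  (Functor.mapHomologicalComplexIdIso C (ComplexShape.up ℤ)).inv ≫
    NatTrans.mapHomologicalComplex τ _

lemma toMapComplex_app_f (τ : 𝟭 C ⟶ F) (K : CochainComplex C ℤ) (n : ℤ) :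
    ((toMapComplex F τ).app K).f n = τ.app (K.X n) :=
  Category.id_comp (τ.app (K.X n))

variable [HasDerivedCategory.{w} C] [PreservesFiniteLimits F] [PreservesFiniteColimits F]

/-- The natural transformation on the derived category induced by a transformation
`𝟭 C ⟶ F` to an exact functor. -/
noncomputable def toMapDerivedCategory (τ : 𝟭 C ⟶ F) :
    𝟭 (DerivedCategory C) ⟶ F.mapDerivedCategory :=
  Localization.liftNatTrans Q (HomologicalComplex.quasiIso C (ComplexShape.up ℤ))
    Q (F.mapHomologicalComplex _ ⋙ Q) _ _ (Functor.whiskerRight (toMapComplex F τ) Q)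

lemma toMapDerivedCategory_app_Q (τ : 𝟭 C ⟶ F) (K : CochainComplex C ℤ) :
    (toMapDerivedCategory F τ).app (Q.obj K) =
      Q.map ((toMapComplex F τ).app K) ≫ F.mapDerivedCategoryFactors.inv.app K :=
  (Localization.liftNatTrans_app ..).trans (Category.id_comp _)

instance isIso_toMapDerivedCategory_app_obj (τ : 𝟭 C ⟶ F) [∀ X, IsIso (τ.app (F.obj X))]
    (X : DerivedCategory C) :
    IsIso ((toMapDerivedCategory F τ).app (F.mapDerivedCategory.obj X)) := by
  let K := Q.objPreimage X
  let e : F.mapDerivedCategory.obj X ≅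
      Q.obj ((F.mapHomologicalComplex (ComplexShape.up ℤ)).obj K) :=
    F.mapDerivedCategory.mapIso (Q.objObjPreimageIso X).symm ≪≫ F.mapDerivedCategoryFactors.app K
  rw [NatTrans.isIso_app_iff_of_iso _ e, toMapDerivedCategory_app_Q]
  have (n : ℤ) : IsIso (((toMapComplex F τ).app
      ((F.mapHomologicalComplex (ComplexShape.up ℤ)).obj K)).f n) := by
    rw [toMapComplex_app_f]
    exact inferInstanceAs (IsIso (τ.app (F.obj (K.X n))))
  have := HomologicalComplex.Hom.isIso_of_components ((toMapComplex F τ).app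
      ((F.mapHomologicalComplex (ComplexShape.up ℤ)).obj K))
  infer_instance

instance isIso_map_toMapDerivedCategory_app (τ : 𝟭 C ⟶ F) [∀ X, IsIso (F.map (τ.app X))]
    (X : DerivedCategory C) :
    IsIso (F.mapDerivedCategory.map ((toMapDerivedCategory F τ).app X)) := by
  let K := Q.objPreimage X
  suffices IsIso (F.mapDerivedCategory.map ((toMapDerivedCategory F τ).app (Q.obj K))) from
    (NatTrans.isIso_app_iff_of_iso (Functor.whiskerRight (toMapDerivedCategory F τ)
      F.mapDerivedCategory) (Q.objObjPreimageIso X)).1 this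
  have (n : ℤ) : IsIso (((F.mapHomologicalComplex (ComplexShape.up ℤ)).map
      ((toMapComplex F τ).app K)).f n) := by
    rw [Functor.mapHomologicalComplex_map_f, toMapComplex_app_f]
    exact inferInstanceAs (IsIso (F.map (τ.app (K.X n))))
  have := HomologicalComplex.Hom.isIso_of_components
    ((F.mapHomologicalComplex (ComplexShape.up ℤ)).map ((toMapComplex F τ).app K))
  have : IsIso (F.mapDerivedCategory.map (Q.map ((toMapComplex F τ).app K))) := by
    have h := F.mapDerivedCategoryFactors_hom_naturality ((toMapComplex F τ).app K)
    rw [← IsIso.eq_comp_inv] at h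
    rw [h]
    infer_instance
  rw [toMapDerivedCategory_app_Q, Functor.map_comp]
  infer_instance

/-- The homology of the image of `X` by an exact functor is the image of the homology. -/
noncomputable def homologyMapDerivedCategoryIso (X : DerivedCategory C) (n : ℤ) :
    (homologyFunctor C n).obj (F.mapDerivedCategory.obj X) ≅
      F.obj ((homologyFunctor C n).obj X) :=
  let K := Q.objPreimage X
  (homologyFunctor C n).mapIso (F.mapDerivedCategory.mapIso (Q.objObjPreimageIso X).symm ≪≫
      F.mapDerivedCategoryFactors.app K) ≪≫
    (homologyFunctorFactors C n).app _ ≪≫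
    (K.sc n).mapHomologyIso F ≪≫
    F.mapIso (((homologyFunctorFactors C n).app K).symm ≪≫
      (homologyFunctor C n).mapIso (Q.objObjPreimageIso X))

open ZeroObject in
lemma isZero_of_forall_isZero_homology (X : DerivedCategory C)
    (h : ∀ n, IsZero ((homologyFunctor C n).obj X)) : IsZero X := by
  have : IsIso (0 : X ⟶ 0) := by
    rw [isIso_iff]
    intro n
    exact (h n).isIso ((homologyFunctor C n).map_isZero (isZero_zero _)) _
  exact (isZero_zero _).of_iso (asIso (0 : X ⟶ 0))

end ExactEndofunctor

end DerivedCategory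

section DTor

variable {A : Type u} [CommRing A] [HasDerivedCategory.{w} (ModuleCat.{u} A)]

lemma DTor_anti {I J : Ideal A} (hIJ : I ≤ J) : DTor.{w} J ⊆ DTor I :=
  fun _ hX n ↦ (hX n).mono hIJ

lemma mem_DTor_sup {I J : Ideal A} (hI : I.FG) (hJ : J.FG)
    {X : DerivedCategory (ModuleCat.{u} A)} (h : X ∈ DTor I) (h' : X ∈ DTor J) :
    X ∈ DTor (I ⊔ J) :=
  fun n ↦ (h n).sup hI hJ (h' n)

lemma mem_DTor_obj₁_of_distTriang {I : Ideal A} (hI : I.FG)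
    (T : Triangle (DerivedCategory (ModuleCat.{u} A))) (hT : T ∈ distTriang _)
    (h₂ : T.obj₂ ∈ DTor I) (h₃ : T.obj₃ ∈ DTor I) : T.obj₁ ∈ DTor I := fun n ↦
  IsTorsionWrt.of_exact hI
    ((ShortComplex.ShortExact.moduleCat_exact_iff_function_exact _).1
      (DerivedCategory.HomologySequence.exact₁ T hT (n - 1) n)) (h₃ (n - 1)) (h₂ n)

open ModuleCat

lemma mem_DTor_mapDerivedCategory_localizationEndofunctor {I : Ideal A} (S : Submonoid A)
    {X : DerivedCategory (ModuleCat.{u} A)} (hX : X ∈ DTor I) :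
    (localizationEndofunctor S).mapDerivedCategory.obj X ∈ DTor I := fun n ↦
  IsTorsionWrt.of_injective
    (DerivedCategory.homologyMapDerivedCategoryIso (localizationEndofunctor S) X
      n).toLinearEquiv.toLinearMap (LinearEquiv.injective _) ((hX n).localizedModule S)

lemma mem_DTor_span_singleton_iff_isZero (x : A) (X : DerivedCategory (ModuleCat.{u} A)) :
    X ∈ DTor (Ideal.span {x}) ↔
      IsZero ((localizationEndofunctor (Submonoid.powers x)).mapDerivedCategory.obj X) := by
  let F := localizationEndofunctor (Submonoid.powers x)
  have key (n : ℤ) : IsTorsionWrt (Ideal.span {x})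
      ((DerivedCategory.homologyFunctor (ModuleCat.{u} A) n).obj X) ↔
      IsZero ((DerivedCategory.homologyFunctor _ n).obj (F.mapDerivedCategory.obj X)) := by
    rw [isTorsionWrt_span_singleton_iff_subsingleton,
      (DerivedCategory.homologyMapDerivedCategoryIso F X n).isZero_iff]
    exact (ModuleCat.isZero_iff_subsingleton
      (M := F.obj ((DerivedCategory.homologyFunctor _ n).obj X))).symm
  exact ⟨fun h ↦ DerivedCategory.isZero_of_forall_isZero_homology _ fun n ↦ (key n).1 (h n),
    fun h n ↦ (key n).2 (Functor.map_isZero _ h)⟩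

lemma eq_zero_of_mem_DTor_span_singleton (x : A) {Y X : DerivedCategory (ModuleCat.{u} A)}
    (hY : Y ∈ DTor (Ideal.span {x}))
    (φ : Y ⟶ (localizationEndofunctor (Submonoid.powers x)).mapDerivedCategory.obj X) :
    φ = 0 := by
  let η := DerivedCategory.toMapDerivedCategory _
    (toLocalizationEndofunctor (Submonoid.powers x))
  rw [← cancel_mono (η.app _), zero_comp]
  refine (η.naturality φ).trans ?_
  rw [((mem_DTor_span_singleton_iff_isZero x Y).1 hY).eq_of_tgt (η.app Y) 0, zero_comp]

lemma mem_DTor_span_singleton_of_distTriang (x : A) {Γ X : DerivedCategory (ModuleCat.{u} A)}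
    (f : Γ ⟶ X)
    (k : (localizationEndofunctor (Submonoid.powers x)).mapDerivedCategory.obj X ⟶ Γ⟦(1 : ℤ)⟧)
    (hT : Triangle.mk f ((DerivedCategory.toMapDerivedCategory _
      (toLocalizationEndofunctor (Submonoid.powers x))).app X) k ∈ distTriang _) :
    Γ ∈ DTor (Ideal.span {x}) := by
  rw [mem_DTor_span_singleton_iff_isZero]
  have h := (localizationEndofunctor (Submonoid.powers x)).mapDerivedCategory.map_distinguished
    _ hT
  exact (Triangle.isZero₁_iff_isIso₂ _ h).2 (DerivedCategory.isIso_map_toMapDerivedCategory_app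
    _ (toLocalizationEndofunctor (Submonoid.powers x)) X)

end DTor

theorem exists_localization_triangle
    {A : Type u} [CommRing A] [IsNoetherianRing A]
    [HasDerivedCategory.{w} (ModuleCat.{u} A)] (I : Ideal A)
    (M : DerivedCategory (ModuleCat.{u} A)) :
    ∃ (Γ l : DerivedCategory (ModuleCat.{u} A)) (f : Γ ⟶ M) (g : M ⟶ l)
      (k : l ⟶ Γ⟦(1 : ℤ)⟧),
      (Triangle.mk f g k ∈ distTriang (DerivedCategory (ModuleCat.{u} A))) ∧
      Γ ∈ DTor I ∧
      (∀ Y ∈ DTor I, ∀ φ : Y ⟶ l, φ = 0) := by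
  obtain ⟨s, rfl⟩ := (isNoetherianRing_iff_ideal_fg A).1 inferInstance I
  classical
  induction s using Finset.induction_on with
  | empty =>
    open ZeroObject in refine ⟨M, 0, 𝟙 M, 0, 0, contractible_distinguished M, fun n ↦ ?_,
      fun Y _ φ ↦ (isZero_zero _).eq_of_tgt _ _⟩
    simpa using isTorsionWrt_bot _
  | insert x s _ ih =>
    obtain ⟨Γ, l, f, g, k, hT, hΓ, hl⟩ := ih
    let L := (ModuleCat.localizationEndofunctor (Submonoid.powers x)).mapDerivedCategory
    obtain ⟨Γ', f', k', hT'⟩ := distinguished_cocone_triangle₁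
      ((DerivedCategory.toMapDerivedCategory _
        (ModuleCat.toLocalizationEndofunctor (Submonoid.powers x))).app Γ)
    obtain ⟨l', g', k'', hT''⟩ := distinguished_cocone_triangle (f' ≫ f)
    have oct := Triangulated.someOctahedron rfl hT' hT hT''
    have hs : (Ideal.span (s : Set A)).FG := ⟨s, rfl⟩
    rw [Finset.coe_insert, Ideal.span_insert]
    refine ⟨Γ', l', f' ≫ f, g', k'', hT'', mem_DTor_sup (Submodule.fg_span_singleton x) hs
      (mem_DTor_span_singleton_of_distTriang x f' k' hT')
      (mem_DTor_obj₁_of_distTriang hs _ hT' hΓ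
        (mem_DTor_mapDerivedCategory_localizationEndofunctor _ hΓ)), fun Y hY φ ↦ ?_⟩
    obtain ⟨ψ, rfl⟩ := Triangle.coyoneda_exact₂ _ oct.mem φ (hl Y (DTor_anti le_sup_right hY) _)
    rw [eq_zero_of_mem_DTor_span_singleton x (DTor_anti le_sup_left hY) ψ]
    exact zero_comp
end
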